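/- Let d ≥ 1 and 1 < p < 1 + 2/d, and let N ∈ ℕ be such that the discrete binding inequalities J(N) < J(K) + J(N−K) hold for all integers 1 ≤ K ≤ N−1. Then the continuous binding inequalities hold: J(N) < J(λ') + J(N−λ') for every real number 0 < λ' < N. -/

import Mathlib

open MeasureTheory Real Filter Topology

noncomputable section

/-- Euclidean space `ℝ^d`. -/
abbrev Ed (d : ℕ) : Type := EuclideanSpace ℝ (Fin d)

/-- An admissible `N`-tuple: each component is continuously differentiable,
square-integrable with square-integrable gradient, and the components are
orthonormal in `L²(ℝ^d)`. -/
structure Admissible (d N : ℕ) (u : Fin N → Ed d → ℂ) : Prop where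
  contDiff : ∀ n, ContDiff ℝ 1 (u n)
  sqInt : ∀ n, Integrable (fun x : Ed d => ‖u n x‖ ^ 2)
  gradSqInt : ∀ n, Integrable (fun x : Ed d => ‖fderiv ℝ (u n) x‖ ^ 2)
  orthonormal : ∀ j k, ∫ x : Ed d, u j x * (starRingEnd ℂ) (u k x)
      = if j = k then 1 else 0

/-- The density `ρ_u = ∑ₙ |uₙ|²` of an `N`-tuple. -/
def density (d N : ℕ) (u : Fin N → Ed d → ℂ) (x : Ed d) : ℝ :=
  ∑ n, ‖u n x‖ ^ 2

/-- The NLS energy of an `N`-tuple. -/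
def energy (d N : ℕ) (p : ℝ) (u : Fin N → Ed d → ℂ) : ℝ :=
  (∑ n, ∫ x : Ed d, ‖fderiv ℝ (u n) x‖ ^ 2)
    - (1 / p) * ∫ x : Ed d, density d N u x ^ p

/-- `J(N)`: the infimum of the energy over admissible `N`-tuples. -/
def J (d : ℕ) (p : ℝ) (N : ℕ) : ℝ :=
  sInf { e : ℝ | ∃ u : Fin N → Ed d → ℂ, Admissible d N u ∧ e = energy d N p u }

/-- The occupation weight: `λ - N + 1` on the last index, `1` otherwise. -/
def wt (N : ℕ) (lam : ℝ) (n : Fin N) : ℝ :=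
  if (n : ℕ) = N - 1 then lam - N + 1 else 1

/-- The weighted density `ρ_{u,λ}`. -/
def densityW (d N : ℕ) (lam : ℝ) (u : Fin N → Ed d → ℂ) (x : Ed d) : ℝ :=
  ∑ n, wt N lam n * ‖u n x‖ ^ 2

/-- The weighted kinetic energy `T_λ(u)`. -/
def kineticW (d N : ℕ) (lam : ℝ) (u : Fin N → Ed d → ℂ) : ℝ :=
  ∑ n, wt N lam n * ∫ x : Ed d, ‖fderiv ℝ (u n) x‖ ^ 2

/-- The weighted energy `E_λ(u)`. -/
def energyW (d N : ℕ) (p lam : ℝ) (u : Fin N → Ed d → ℂ) : ℝ :=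
  kineticW d N lam u - (1 / p) * ∫ x : Ed d, densityW d N lam u x ^ p

/-- `J(λ)` for real `λ`: the infimum of the weighted energy over admissible
`⌈λ⌉`-tuples. -/
def Jw (d : ℕ) (p : ℝ) (lam : ℝ) : ℝ :=
  sInf { e : ℝ | ∃ u : Fin ⌈lam⌉₊ → Ed d → ℂ,
    Admissible d ⌈lam⌉₊ u ∧ e = energyW d ⌈lam⌉₊ p lam u }

/-- The one-function NLS infimum `I(d,p,λ)`. -/
def Infimum1 (d : ℕ) (p lam : ℝ) : ℝ :=
  sInf { e : ℝ | ∃ u : Ed d → ℂ, ContDiff ℝ 1 u ∧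
    Integrable (fun x : Ed d => ‖u x‖ ^ 2) ∧
    Integrable (fun x : Ed d => ‖fderiv ℝ u x‖ ^ 2) ∧
    (∫ x : Ed d, ‖u x‖ ^ 2) = lam ∧
    e = (∫ x : Ed d, ‖fderiv ℝ u x‖ ^ 2)
        - (1 / p) * ∫ x : Ed d, ‖u x‖ ^ (2 * p) }

/-- The Laplacian of `f : ℝ^d → ℂ`, as the sum of the second partial
derivatives in the coordinate directions. -/
def lap (d : ℕ) (f : Ed d → ℂ) (x : Ed d) : ℂ :=
  ∑ i : Fin d,
    fderiv ℝ (fun y => fderiv ℝ f y (EuclideanSpace.single i (1 : ℝ))) x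
      (EuclideanSpace.single i (1 : ℝ))

/-- The `q`-spherical average `[f]_q(x)`, computed with respect to the surface
measure on the unit sphere. -/
def sphAvg (d : ℕ) (q : ℝ) (f : Ed d → ℝ) (x : Ed d) : ℝ :=
  (∫ ω : Metric.sphere (0 : Ed d) 1, |f (‖x‖ • (ω : Ed d))| ^ q
      ∂((volume : Measure (Ed d)).toSphere)) ^ (1 / q)

/-- The surface measure of the unit sphere `S^{d-1} ⊂ ℝ^d`. -/
def omegaSphere (d : ℕ) : ℝ :=
  (((volume : Measure (Ed d)).toSphere) Set.univ).toReal

/-- The Thomas–Fermi constant. -/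
def cTF (d : ℕ) : ℝ :=
  (4 * π ^ 2 * d / (d + 2)) * ((d : ℝ) / omegaSphere d) ^ (2 / (d : ℝ))


lemma sq_lintegral_le_lintegral_sq {α : Type*} [MeasurableSpace α] (μ : Measure α)
    [IsProbabilityMeasure μ] {g : α → ENNReal} (hg : AEMeasurable g μ) :
    (∫⁻ a, g a ∂μ) ^ 2 ≤ ∫⁻ a, g a ^ 2 ∂μ := by
  have h := ENNReal.lintegral_mul_le_Lp_mul_Lq μ Real.HolderConjugate.two_two hg
    (aemeasurable_const (b := (1 : ENNReal)))
  simp only [Pi.mul_apply, mul_one, ENNReal.one_rpow, lintegral_const, measure_univ] at h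
  calc (∫⁻ a, g a ∂μ) ^ 2 ≤ ((∫⁻ a, g a ^ (2 : ℝ) ∂μ) ^ (1 / 2 : ℝ)) ^ 2 := by gcongr
    _ = ∫⁻ a, g a ^ 2 ∂μ := by
      rw [← ENNReal.rpow_natCast, ← ENNReal.rpow_mul]
      norm_num

lemma enorm_sub_sq_le_lintegral_fderiv {E F : Type*} [NormedAddCommGroup E] [NormedSpace ℝ E]
    [NormedAddCommGroup F] [NormedSpace ℝ F] [CompleteSpace F]
    {u : E → F} (hu : ContDiff ℝ 1 u) (x y : E) :
    ‖u (x + y) - u x‖ₑ ^ 2 ≤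
      ∫⁻ t in Set.Ioc (0 : ℝ) 1, ‖y‖ₑ ^ 2 * ‖fderiv ℝ u (x + t • y)‖ₑ ^ 2 := by
  have hc : Continuous fun t : ℝ => fderiv ℝ u (x + t • y) :=
    (hu.continuous_fderiv one_ne_zero).comp (by fun_prop)
  have hftc : ∫ t in (0 : ℝ)..1, fderiv ℝ u (x + t • y) y = u (x + y) - u x := by
    have := intervalIntegral.integral_eq_sub_of_hasDerivAt (a := (0 : ℝ)) (b := 1)
      (f := fun t : ℝ => u (x + t • y)) (f' := fun t => fderiv ℝ u (x + t • y) y) ?_ ?_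
    · simpa using this
    · intro t _
      have h1 : HasDerivAt (fun t : ℝ => x + t • y) y t := by
        simpa using ((hasDerivAt_id t).smul_const y).const_add x
      exact ((hu.differentiable one_ne_zero _).hasFDerivAt).comp_hasDerivAt t h1
    · exact (hc.clm_apply continuous_const).intervalIntegrable _ _
  have : IsProbabilityMeasure (volume.restrict (Set.Ioc (0 : ℝ) 1)) := ⟨by simp⟩
  rw [← hftc, intervalIntegral.integral_of_le zero_le_one]
  calc ‖∫ t in Set.Ioc (0 : ℝ) 1, fderiv ℝ u (x + t • y) y‖ₑ ^ 2
      ≤ (∫⁻ t in Set.Ioc (0 : ℝ) 1, ‖y‖ₑ * ‖fderiv ℝ u (x + t • y)‖ₑ) ^ 2 := by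
        gcongr
        refine (enorm_integral_le_lintegral_enorm _).trans (lintegral_mono fun t => ?_)
        rw [mul_comm]
        exact (fderiv ℝ u (x + t • y)).le_opENorm y
    _ ≤ ∫⁻ t in Set.Ioc (0 : ℝ) 1, (‖y‖ₑ * ‖fderiv ℝ u (x + t • y)‖ₑ) ^ 2 :=
        sq_lintegral_le_lintegral_sq _
          (hc.enorm.measurable.const_mul _).aemeasurable
    _ = _ := by simp_rw [mul_pow]

lemma lintegral_enorm_translate_sub_sq_le {d : ℕ} {u : Ed d → ℂ} (hu : ContDiff ℝ 1 u)
    (y : Ed d) :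
    ∫⁻ x, ‖u (x + y) - u x‖ₑ ^ 2 ≤ ‖y‖ₑ ^ 2 * ∫⁻ x, ‖fderiv ℝ u x‖ₑ ^ 2 := by
  have hcf := hu.continuous_fderiv one_ne_zero
  calc ∫⁻ x, ‖u (x + y) - u x‖ₑ ^ 2
      ≤ ∫⁻ x, ∫⁻ t in Set.Ioc (0 : ℝ) 1, ‖y‖ₑ ^ 2 * ‖fderiv ℝ u (x + t • y)‖ₑ ^ 2 :=
        lintegral_mono fun x => enorm_sub_sq_le_lintegral_fderiv hu x y
    _ = ∫⁻ t in Set.Ioc (0 : ℝ) 1, ∫⁻ x, ‖y‖ₑ ^ 2 * ‖fderiv ℝ u (x + t • y)‖ₑ ^ 2 := by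
        refine lintegral_lintegral_swap (Measurable.aemeasurable ?_)
        have : Continuous fun z : Ed d × ℝ => fderiv ℝ u (z.1 + z.2 • y) :=
          hcf.comp (by fun_prop)
        exact (this.enorm.measurable.pow_const 2).const_mul _
    _ = ∫⁻ t in Set.Ioc (0 : ℝ) 1, ‖y‖ₑ ^ 2 * ∫⁻ x, ‖fderiv ℝ u x‖ₑ ^ 2 := by
        refine lintegral_congr fun t => ?_
        have : Continuous fun x : Ed d => fderiv ℝ u (x + t • y) := hcf.comp (by fun_prop)
        rw [lintegral_const_mul _ (this.enorm.measurable.pow_const 2),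
          lintegral_add_right_eq_self (fun x => ‖fderiv ℝ u x‖ₑ ^ 2) (t • y)]
    _ = _ := by simp

lemma enorm_sq_le_two_mul_add {E : Type*} [NormedAddCommGroup E] (a b : E) :
    ‖a‖ₑ ^ 2 ≤ 2 * ‖b - a‖ₑ ^ 2 + 2 * ‖b‖ₑ ^ 2 := by
  have h : ‖a‖ ^ 2 ≤ 2 * ‖b - a‖ ^ 2 + 2 * ‖b‖ ^ 2 := by
    have h1 : ‖a‖ ≤ ‖b - a‖ + ‖b‖ := by
      rw [norm_sub_rev]; simpa using norm_add_le (a - b) b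
    nlinarith [sq_nonneg (‖b - a‖ - ‖b‖), norm_nonneg a]
  simp only [← ofReal_norm]
  rw [← ENNReal.ofReal_pow (norm_nonneg _), ← ENNReal.ofReal_pow (norm_nonneg _),
    ← ENNReal.ofReal_pow (norm_nonneg _), ← ENNReal.ofReal_ofNat 2,
    ← ENNReal.ofReal_mul (by positivity), ← ENNReal.ofReal_mul (by positivity),
    ← ENNReal.ofReal_add (by positivity) (by positivity)]
  exact ENNReal.ofReal_le_ofReal h

/-- The mass of a normalised function above a level `s` is controlled by its kinetic energy:
compare `u` with its averages over balls of radius `t`, which are at most of order `s`. -/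
lemma setLIntegral_enorm_sq_le {d : ℕ} {u : Ed d → ℂ} (hu : ContDiff ℝ 1 u)
    (hM : ∫⁻ x, ‖u x‖ₑ ^ 2 = 1) {t : ℝ} (ht : 0 < t) {s : ENNReal}
    (hs : 4 ≤ volume (Metric.ball (0 : Ed d) t) * s) :
    ∫⁻ x in {x | s < ‖u x‖ₑ ^ 2}, ‖u x‖ₑ ^ 2 ≤
      4 * ENNReal.ofReal t ^ 2 * ∫⁻ x, ‖fderiv ℝ u x‖ₑ ^ 2 := by
  set B := Metric.ball (0 : Ed d) t
  set V := volume B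
  have hV0 : V ≠ 0 := (Metric.measure_ball_pos volume _ ht).ne'
  have hVtop : V ≠ ⊤ := measure_ball_lt_top.ne
  have hcu := hu.continuous
  have hS : MeasurableSet {x | s < ‖u x‖ₑ ^ 2} :=
    measurableSet_lt measurable_const (hcu.enorm.measurable.pow_const 2)
  have hmeas : Measurable fun z : Ed d × Ed d => ‖u (z.1 + z.2) - u z.1‖ₑ ^ 2 := by
    have : Continuous fun z : Ed d × Ed d => u (z.1 + z.2) - u z.1 := by fun_prop
    exact this.enorm.measurable.pow_const 2
  have hpt : ∀ x ∈ {x | s < ‖u x‖ₑ ^ 2},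
      V * ‖u x‖ₑ ^ 2 ≤ 4 * ∫⁻ y in B, ‖u (x + y) - u x‖ₑ ^ 2 := by
    intro x hx
    have hm1 : Measurable fun y : Ed d => ‖u (x + y) - u x‖ₑ ^ 2 := by
      have : Continuous fun y : Ed d => u (x + y) - u x := by fun_prop
      exact this.enorm.measurable.pow_const 2
    have h1 : V * ‖u x‖ₑ ^ 2 ≤ 2 * (∫⁻ y in B, ‖u (x + y) - u x‖ₑ ^ 2) + 2 := by
      calc V * ‖u x‖ₑ ^ 2 = ∫⁻ y in B, ‖u x‖ₑ ^ 2 := by simp [V, mul_comm]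
        _ ≤ ∫⁻ y in B, (2 * ‖u (x + y) - u x‖ₑ ^ 2 + 2 * ‖u (x + y)‖ₑ ^ 2) :=
          lintegral_mono fun y => enorm_sq_le_two_mul_add _ _
        _ = 2 * (∫⁻ y in B, ‖u (x + y) - u x‖ₑ ^ 2)
            + 2 * ∫⁻ y in B, ‖u (x + y)‖ₑ ^ 2 := by
          rw [lintegral_add_left (hm1.const_mul _), lintegral_const_mul' _ _ (by simp),
            lintegral_const_mul' _ _ (by simp)]
        _ ≤ _ := by
          gcongr
          calc 2 * ∫⁻ y in B, ‖u (x + y)‖ₑ ^ 2 ≤ 2 * ∫⁻ y, ‖u (x + y)‖ₑ ^ 2 := by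
                gcongr; exact Measure.restrict_le_self
            _ = 2 := by
                rw [lintegral_add_left_eq_self (fun y => ‖u y‖ₑ ^ 2) x, hM, mul_one]
    have h2 : 4 ≤ V * ‖u x‖ₑ ^ 2 := hs.trans (by gcongr; exact le_of_lt hx)
    have hfin : V * ‖u x‖ₑ ^ 2 ≠ ⊤ :=
      ENNReal.mul_ne_top hVtop (ENNReal.pow_ne_top enorm_ne_top)
    rw [← ENNReal.add_le_add_iff_right hfin]
    calc V * ‖u x‖ₑ ^ 2 + V * ‖u x‖ₑ ^ 2
        ≤ (2 * (∫⁻ y in B, ‖u (x + y) - u x‖ₑ ^ 2) + 2)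
          + (2 * (∫⁻ y in B, ‖u (x + y) - u x‖ₑ ^ 2) + 2) := add_le_add h1 h1
      _ = 4 * (∫⁻ y in B, ‖u (x + y) - u x‖ₑ ^ 2) + 4 := by ring
      _ ≤ _ := by gcongr
  have hint : V * ∫⁻ x in {x | s < ‖u x‖ₑ ^ 2}, ‖u x‖ₑ ^ 2 ≤
      V * (4 * ENNReal.ofReal t ^ 2 * ∫⁻ x, ‖fderiv ℝ u x‖ₑ ^ 2) := by
    rw [← lintegral_const_mul' _ _ hVtop]
    calc ∫⁻ x in {x | s < ‖u x‖ₑ ^ 2}, V * ‖u x‖ₑ ^ 2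
        ≤ ∫⁻ x in {x | s < ‖u x‖ₑ ^ 2}, 4 * ∫⁻ y in B, ‖u (x + y) - u x‖ₑ ^ 2 :=
          setLIntegral_mono' hS hpt
      _ ≤ ∫⁻ x, 4 * ∫⁻ y in B, ‖u (x + y) - u x‖ₑ ^ 2 := setLIntegral_le_lintegral _ _
      _ = 4 * ∫⁻ y in B, ∫⁻ x, ‖u (x + y) - u x‖ₑ ^ 2 := by
          rw [lintegral_const_mul' _ _ (by simp)]
          rw [lintegral_lintegral_swap hmeas.aemeasurable]
      _ ≤ 4 * ∫⁻ y in B, ENNReal.ofReal t ^ 2 * ∫⁻ x, ‖fderiv ℝ u x‖ₑ ^ 2 := by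
          gcongr 4 * ?_
          refine setLIntegral_mono' measurableSet_ball fun y hy => ?_
          refine (lintegral_enorm_translate_sub_sq_le hu y).trans ?_
          gcongr
          rw [← ofReal_norm]
          exact ENNReal.ofReal_le_ofReal (by simpa [B] using le_of_lt (mem_ball_zero_iff.1 hy))
      _ = _ := by rw [setLIntegral_const]; ring
  rwa [ENNReal.mul_le_mul_iff_right hV0 hVtop] at hint

lemma exists_geometric_shell {b D a : ℝ} (hb : 0 < b) (hD : 1 < D) {k₀ : ℕ}
    (ha : b * D ^ k₀ < a) :
    ∃ j : ℕ, b * D ^ (k₀ + j) < a ∧ a ≤ b * D ^ (k₀ + j + 1) := by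
  classical
  have hex : ∃ n : ℕ, a ≤ b * D ^ (k₀ + n) := by
    obtain ⟨n, hn⟩ := pow_unbounded_of_one_lt (a / b) hD
    refine ⟨n, ?_⟩
    rw [div_lt_iff₀' hb] at hn
    refine hn.le.trans ?_
    gcongr
    · exact hD.le
    · omega
  obtain ⟨j, hj⟩ : ∃ j, Nat.find hex = j + 1 := Nat.exists_eq_succ_of_ne_zero fun h0 => by
    have := Nat.find_spec hex
    rw [h0, add_zero] at this
    linarith
  refine ⟨j, not_le.1 (Nat.find_min hex (by omega)), ?_⟩
  have := Nat.find_spec hex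
  rwa [hj, ← add_assoc] at this

lemma lintegral_rpow_le {d : ℕ} (hd : 1 ≤ d) {p : ℝ} (hp1 : 1 < p) (hp2 : p < 1 + 2 / d)
    {ε : ℝ} (hε : 0 < ε) :
    ∃ C : ℝ, 0 ≤ C ∧ ∀ u : Ed d → ℂ, ContDiff ℝ 1 u → ∫⁻ x, ‖u x‖ₑ ^ 2 = 1 →
      ∫⁻ x, (‖u x‖ₑ ^ 2) ^ p ≤
        ENNReal.ofReal C + ENNReal.ofReal ε * ∫⁻ x, ‖fderiv ℝ u x‖ₑ ^ 2 := by
  set c := (volume (Metric.ball (0 : Ed d) 1)).toReal with hc_def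
  have hc : 0 < c :=
    ENNReal.toReal_pos (Metric.measure_ball_pos volume _ one_pos).ne' measure_ball_lt_top.ne
  have hd0 : (0 : ℝ) < d := by exact_mod_cast hd
  set q := p - 1 with hq_def
  have hq : 0 < q := by linarith
  set b := 4 / c with hb_def
  have hb : 0 < b := by positivity
  set s : ℕ → ℝ := fun k => b * (2 ^ d) ^ k with hs_def
  have hs0 : ∀ k, 0 < s k := fun k => by positivity
  have h2d : (1 : ℝ) < 2 ^ d := one_lt_pow₀ one_lt_two (by omega)
  set D : ℝ := (2 ^ d : ℝ) ^ q with hD_def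
  have hD0 : 0 < D := by positivity
  have hD4 : D < 4 := by
    have h1 : (d : ℝ) * q < 2 := by
      have : q < 2 / d := by linarith
      rwa [lt_div_iff₀ hd0, mul_comm] at this
    calc D = (2 : ℝ) ^ ((d : ℝ) * q) := by
          rw [hD_def, Real.rpow_mul (by norm_num), Real.rpow_natCast]
      _ < (2 : ℝ) ^ (2 : ℝ) := Real.rpow_lt_rpow_of_exponent_lt one_lt_two h1
      _ = 4 := by norm_num
  set r := D / 4 with hr_def
  have hr0 : 0 < r := by positivity
  have hr1 : r < 1 := by rw [hr_def, div_lt_one (by norm_num)]; exact hD4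
  have hsq : ∀ k, s k ^ q = b ^ q * D ^ k := fun k => by
    rw [hs_def, Real.mul_rpow hb.le (by positivity), hD_def, ← Real.rpow_natCast,
      ← Real.rpow_mul (by positivity), mul_comm (k : ℝ) q, Real.rpow_mul (by positivity),
      Real.rpow_natCast]
  set A : ℝ := 4 * b ^ q * D with hA_def
  have hA0 : 0 < A := by positivity
  obtain ⟨k₀, hk₀⟩ := exists_pow_lt_of_lt_one (show 0 < ε * (1 - r) / A by
    have : 0 < 1 - r := by linarith
    positivity) hr1
  have hk₀' : A * r ^ k₀ * (1 - r)⁻¹ ≤ ε := by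
    have h1r : 0 < 1 - r := by linarith
    rw [lt_div_iff₀ hA0] at hk₀
    rw [← div_eq_mul_inv, div_le_iff₀ h1r]
    linarith
  refine ⟨s k₀ ^ q, by have := hs0 k₀; positivity, fun u hu hM => ?_⟩
  set T := ∫⁻ x, ‖fderiv ℝ u x‖ₑ ^ 2
  have hcu : Measurable fun x => ‖u x‖ₑ ^ 2 := hu.continuous.enorm.measurable.pow_const 2
  set S : ℕ → Set (Ed d) := fun j => {x | ENNReal.ofReal (s (k₀ + j)) < ‖u x‖ₑ ^ 2} with hS_def
  have hS : ∀ j, MeasurableSet (S j) := fun j => measurableSet_lt measurable_const hcu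
  have hpt : ∀ x, (‖u x‖ₑ ^ 2) ^ p ≤ ENNReal.ofReal (s k₀ ^ q) * ‖u x‖ₑ ^ 2 +
      ∑' j, ENNReal.ofReal (s (k₀ + j + 1) ^ q) * (S j).indicator (fun x => ‖u x‖ₑ ^ 2) x := by
    intro x
    have hux : ‖u x‖ₑ ^ 2 = ENNReal.ofReal (‖u x‖ ^ 2) := by
      rw [← ofReal_norm, ENNReal.ofReal_pow (norm_nonneg _)]
    have hsplit : (‖u x‖ₑ ^ 2) ^ p = (‖u x‖ₑ ^ 2) ^ q * ‖u x‖ₑ ^ 2 := by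
      conv_rhs => rw [← ENNReal.rpow_one (‖u x‖ₑ ^ 2), ← ENNReal.rpow_mul, one_mul]
      rw [← ENNReal.rpow_add_of_nonneg _ _ hq.le zero_le_one, hq_def, sub_add_cancel]
    have hle : ∀ k, ‖u x‖ ^ 2 ≤ s k → (‖u x‖ₑ ^ 2) ^ q ≤ ENNReal.ofReal (s k ^ q) := by
      intro k hk
      rw [hux, ← ENNReal.ofReal_rpow_of_pos (hs0 k)]
      exact ENNReal.rpow_le_rpow (ENNReal.ofReal_le_ofReal hk) hq.le
    rw [hsplit]
    rcases le_or_gt (‖u x‖ ^ 2) (s k₀) with h | h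
    · exact le_add_right (mul_le_mul_left (hle _ h) _)
    · obtain ⟨j, hj, hj'⟩ := exists_geometric_shell hb h2d h
      refine le_add_left (le_trans ?_ (ENNReal.le_tsum j))
      have hmem : x ∈ S j := by
        rw [hS_def, Set.mem_ofPred_eq, hux]
        exact (ENNReal.ofReal_lt_ofReal_iff_of_nonneg (hs0 _).le).2 hj
      rw [Set.indicator_of_mem hmem]
      exact mul_le_mul_left (hle _ hj') _
  have htail : ∀ j, ∫⁻ x in S j, ‖u x‖ₑ ^ 2 ≤ ENNReal.ofReal (4 * (1 / 4) ^ (k₀ + j)) * T := by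
    intro j
    have h := setLIntegral_enorm_sq_le hu hM (t := (1 / 2) ^ (k₀ + j)) (by positivity)
      (s := ENNReal.ofReal (s (k₀ + j))) (by
        rw [Measure.addHaar_ball_of_pos _ _ (by positivity), ← ENNReal.ofReal_toReal
          (measure_ball_lt_top (μ := volume) (x := (0 : Ed d)) (r := 1)).ne, ← hc_def,
          ← ENNReal.ofReal_mul (by positivity), ← ENNReal.ofReal_mul (by positivity),
          finrank_euclideanSpace_fin, ← ENNReal.ofReal_ofNat 4]
        refine ENNReal.ofReal_le_ofReal (le_of_eq ?_)
        have h1 : ((1 / 2 : ℝ) ^ (k₀ + j)) ^ d * (2 ^ d) ^ (k₀ + j) = 1 := by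
          rw [← pow_mul, ← pow_mul, mul_comm d, ← mul_pow]; norm_num
        calc (4 : ℝ) = (((1 / 2 : ℝ) ^ (k₀ + j)) ^ d * (2 ^ d) ^ (k₀ + j)) * (c * b) := by
              rw [h1, hb_def]; field_simp
          _ = _ := by rw [hs_def]; ring)
    refine h.trans (le_of_eq ?_)
    congr 1
    rw [← ENNReal.ofReal_pow (by positivity), ← ENNReal.ofReal_ofNat 4,
      ← ENNReal.ofReal_mul (by positivity), ← pow_mul, mul_comm (k₀ + j) 2, pow_mul]
    norm_num
  calc ∫⁻ x, (‖u x‖ₑ ^ 2) ^ p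
      ≤ ∫⁻ x, (ENNReal.ofReal (s k₀ ^ q) * ‖u x‖ₑ ^ 2 +
          ∑' j, ENNReal.ofReal (s (k₀ + j + 1) ^ q) *
            (S j).indicator (fun x => ‖u x‖ₑ ^ 2) x) := lintegral_mono hpt
    _ = ENNReal.ofReal (s k₀ ^ q) +
          ∑' j, ENNReal.ofReal (s (k₀ + j + 1) ^ q) * ∫⁻ x in S j, ‖u x‖ₑ ^ 2 := by
        rw [lintegral_add_left (hcu.const_mul _), lintegral_const_mul _ hcu, hM, mul_one,
          lintegral_tsum fun j => ((hcu.indicator (hS j)).const_mul _).aemeasurable]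
        congr 1
        refine tsum_congr fun j => ?_
        rw [lintegral_const_mul _ (hcu.indicator (hS j)), lintegral_indicator (hS j)]
    _ ≤ ENNReal.ofReal (s k₀ ^ q) + ∑' j : ℕ, ENNReal.ofReal (A * r ^ k₀ * r ^ j) * T := by
        refine add_le_add le_rfl (ENNReal.tsum_le_tsum fun j => ?_)
        calc ENNReal.ofReal (s (k₀ + j + 1) ^ q) * ∫⁻ x in S j, ‖u x‖ₑ ^ 2
            ≤ ENNReal.ofReal (s (k₀ + j + 1) ^ q) *
                (ENNReal.ofReal (4 * (1 / 4) ^ (k₀ + j)) * T) := mul_le_mul_right (htail j) _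
          _ = _ := by
            rw [← mul_assoc, ← ENNReal.ofReal_mul (by have := hs0 (k₀ + j + 1); positivity)]
            congr 2
            rw [hsq, hA_def, hr_def, mul_assoc _ ((D / 4) ^ k₀), ← pow_add, div_pow, div_pow,
              one_pow, pow_succ]
            ring
    _ ≤ _ := by
        gcongr
        rw [ENNReal.tsum_mul_right, ← ENNReal.ofReal_tsum_of_nonneg (fun j => by positivity)
          ((summable_geometric_of_lt_one hr0.le hr1).mul_left _), tsum_mul_left,
          tsum_geometric_of_lt_one hr0.le hr1]
        gcongr

lemma integrable_rpow_and_integral_le {d : ℕ} (hd : 1 ≤ d) {p : ℝ} (hp1 : 1 < p)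
    (hp2 : p < 1 + 2 / d) {ε : ℝ} (hε : 0 < ε) :
    ∃ C : ℝ, 0 ≤ C ∧ ∀ u : Ed d → ℂ, ContDiff ℝ 1 u → Integrable (fun x => ‖u x‖ ^ 2) →
      Integrable (fun x => ‖fderiv ℝ u x‖ ^ 2) → ∫ x, ‖u x‖ ^ 2 = 1 →
      Integrable (fun x => (‖u x‖ ^ 2) ^ p) ∧
        ∫ x, (‖u x‖ ^ 2) ^ p ≤ C + ε * ∫ x, ‖fderiv ℝ u x‖ ^ 2 := by
  obtain ⟨C, hC, h⟩ := lintegral_rpow_le hd hp1 hp2 hε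
  refine ⟨C, hC, fun u hu hi hgi h1 => ?_⟩
  have hp0 : 0 ≤ p := by linarith
  have e1 : ∀ x, ‖u x‖ₑ ^ 2 = ENNReal.ofReal (‖u x‖ ^ 2) := fun x => by
    rw [← ofReal_norm, ENNReal.ofReal_pow (norm_nonneg _)]
  have e2 : ∀ x, ‖fderiv ℝ u x‖ₑ ^ 2 = ENNReal.ofReal (‖fderiv ℝ u x‖ ^ 2) := fun x => by
    rw [← ofReal_norm, ENNReal.ofReal_pow (norm_nonneg _)]
  have h2 := h u hu (by
    simp_rw [e1]
    rw [← ofReal_integral_eq_lintegral_ofReal hi (ae_of_all _ fun x => by positivity), h1,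
      ENNReal.ofReal_one])
  have hT : 0 ≤ ∫ x, ‖fderiv ℝ u x‖ ^ 2 := integral_nonneg fun x => by positivity
  simp_rw [e1, e2] at h2
  rw [← ofReal_integral_eq_lintegral_ofReal hgi (ae_of_all _ fun x => by positivity),
    ← ENNReal.ofReal_mul hε.le, ← ENNReal.ofReal_add hC (by positivity)] at h2
  simp_rw [ENNReal.ofReal_rpow_of_nonneg (sq_nonneg ‖u _‖) hp0] at h2
  have hcont : Continuous fun x => (‖u x‖ ^ 2) ^ p :=
    (hu.continuous.norm.pow 2).rpow_const fun _ => Or.inr hp0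
  have hint : Integrable (fun x => (‖u x‖ ^ 2) ^ p) := by
    refine ⟨hcont.aestronglyMeasurable, ?_⟩
    rw [hasFiniteIntegral_iff_ofReal (ae_of_all _ fun x => by positivity)]
    exact h2.trans_lt ENNReal.ofReal_lt_top
  refine ⟨hint, ?_⟩
  rw [← ofReal_integral_eq_lintegral_ofReal hint (ae_of_all _ fun x => by positivity)] at h2
  exact (ENNReal.ofReal_le_ofReal_iff (by positivity)).1 h2

lemma Admissible.integral_norm_sq {d N : ℕ} {u : Fin N → Ed d → ℂ} (hu : Admissible d N u)
    (n : Fin N) : ∫ x, ‖u n x‖ ^ 2 = 1 := by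
  have h := hu.orthonormal n n
  simp only [Complex.mul_conj', if_true] at h
  have h2 : ((∫ x, ‖u n x‖ ^ 2 : ℝ) : ℂ) = 1 := by
    rw [← h, ← integral_complex_ofReal]
    simp
  exact_mod_cast h2

lemma Admissible.castSucc {d N : ℕ} {u : Fin (N + 1) → Ed d → ℂ}
    (hu : Admissible d (N + 1) u) : Admissible d N fun n => u n.castSucc where
  contDiff n := hu.contDiff _
  sqInt n := hu.sqInt _
  gradSqInt n := hu.gradSqInt _
  orthonormal j k := by simpa using hu.orthonormal j.castSucc k.castSucc

lemma density_nonneg {d N : ℕ} (u : Fin N → Ed d → ℂ) (x : Ed d) : 0 ≤ density d N u x :=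
  Finset.sum_nonneg fun _ _ => by positivity

lemma density_rpow_le {d N : ℕ} {p : ℝ} (hp : 1 ≤ p) (u : Fin N → Ed d → ℂ) (x : Ed d) :
    density d N u x ^ p ≤ (N : ℝ) ^ (p - 1) * ∑ n, (‖u n x‖ ^ 2) ^ p := by
  have h := Real.rpow_sum_le_const_mul_sum_rpow Finset.univ (fun n => ‖u n x‖ ^ 2) hp
  simpa only [density, abs_pow, abs_norm, Finset.card_univ, Fintype.card_fin] using h

lemma exists_integral_density_rpow_le {d : ℕ} (hd : 1 ≤ d) {p : ℝ} (hp1 : 1 < p)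
    (hp2 : p < 1 + 2 / d) (N : ℕ) :
    ∃ C : ℝ, 0 ≤ C ∧ ∀ u : Fin N → Ed d → ℂ, Admissible d N u →
      Integrable (fun x => density d N u x ^ p) ∧
        ∫ x, density d N u x ^ p ≤ C + ∑ n, ∫ x, ‖fderiv ℝ (u n) x‖ ^ 2 := by
  set κ : ℝ := (N : ℝ) ^ (p - 1)
  have hκ : 0 ≤ κ := by positivity
  obtain ⟨C, hC, h⟩ := integrable_rpow_and_integral_le hd hp1 hp2
    (ε := 1 / (κ + 1)) (by positivity)
  refine ⟨κ * (N * C), by positivity, fun u hu => ?_⟩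
  have hn := fun n =>
    h (u n) (hu.contDiff n) (hu.sqInt n) (hu.gradSqInt n) (hu.integral_norm_sq n)
  have hdom : Integrable fun x => κ * ∑ n, (‖u n x‖ ^ 2) ^ p :=
    (integrable_finsetSum _ fun n _ => (hn n).1).const_mul _
  have hnonneg : ∀ x, 0 ≤ density d N u x ^ p := fun x =>
    Real.rpow_nonneg (density_nonneg u x) p
  have hcont : Continuous fun x => density d N u x ^ p := by
    refine Continuous.rpow_const ?_ fun _ => Or.inr (by linarith)
    exact continuous_finsetSum _ fun n _ => (hu.contDiff n).continuous.norm.pow 2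
  have hle := density_rpow_le hp1.le u
  refine ⟨hdom.mono' hcont.aestronglyMeasurable (ae_of_all _ fun x => ?_), ?_⟩
  · rw [Real.norm_of_nonneg (hnonneg x)]
    exact hle x
  set T := ∑ n, ∫ x, ‖fderiv ℝ (u n) x‖ ^ 2
  have hT : 0 ≤ T := Finset.sum_nonneg fun n _ => integral_nonneg fun x => by positivity
  calc ∫ x, density d N u x ^ p ≤ ∫ x, κ * ∑ n, (‖u n x‖ ^ 2) ^ p :=
        integral_mono_of_nonneg (ae_of_all _ hnonneg) hdom (ae_of_all _ hle)
    _ = κ * ∑ n, ∫ x, (‖u n x‖ ^ 2) ^ p := by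
        rw [integral_const_mul, integral_finsetSum _ fun n _ => (hn n).1]
    _ ≤ κ * ∑ n, (C + 1 / (κ + 1) * ∫ x, ‖fderiv ℝ (u n) x‖ ^ 2) := by
        gcongr with n; exact (hn n).2
    _ = κ * (N * C) + κ / (κ + 1) * T := by
        rw [Finset.sum_add_distrib, ← Finset.mul_sum]
        simp only [Finset.sum_const, Finset.card_univ, Fintype.card_fin, nsmul_eq_mul]
        ring
    _ ≤ κ * (N * C) + T := by
        gcongr
        exact mul_le_of_le_one_left hT ((div_le_one (by positivity)).2 (by linarith))

lemma J_le_energy {d : ℕ} (hd : 1 ≤ d) {p : ℝ} (hp1 : 1 < p) (hp2 : p < 1 + 2 / d) {N : ℕ}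
    {u : Fin N → Ed d → ℂ} (hu : Admissible d N u) : J d p N ≤ energy d N p u := by
  obtain ⟨C, hC, h⟩ := exists_integral_density_rpow_le hd hp1 hp2 N
  refine csInf_le ⟨-C, ?_⟩ ⟨u, hu, rfl⟩
  rintro _ ⟨v, hv, rfl⟩
  have h1 := (h v hv).2
  have h2 : 0 ≤ ∫ x, density d N v x ^ p :=
    integral_nonneg fun x => Real.rpow_nonneg (density_nonneg v x) p
  have h3 : 1 / p * ∫ x, density d N v x ^ p ≤ ∫ x, density d N v x ^ p :=
    mul_le_of_le_one_left h2 ((div_le_one (by linarith)).2 hp1.le)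
  unfold energy
  linarith

lemma exists_normalized_bump {d : ℕ} :
    ∃ φ : Ed d → ℂ, ContDiff ℝ 1 φ ∧ HasCompactSupport φ ∧
      Function.support φ ⊆ Metric.ball 0 1 ∧ ∫ x, ‖φ x‖ ^ 2 = 1 := by
  let f : ContDiffBump (0 : Ed d) := ⟨1 / 2, 1, by norm_num, by norm_num⟩
  have hcont : Continuous fun x => f x ^ 2 := f.continuous.pow 2
  have hcs : HasCompactSupport fun x => f x ^ 2 :=
    f.hasCompactSupport.comp_left (g := fun t : ℝ => t ^ 2) (by simp)
  have hM : 0 < ∫ x, f x ^ 2 :=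
    hcont.integral_pos_of_hasCompactSupport_nonneg_nonzero hcs (fun x => sq_nonneg (f x))
      (x := 0) (by
        rw [f.one_of_mem_closedBall (by simp [f.rIn_pos.le])]
        norm_num)
  set M := ∫ x, f x ^ 2
  refine ⟨fun x => (((√M)⁻¹ * f x : ℝ) : ℂ), ?_, ?_, ?_, ?_⟩
  · exact Complex.ofRealCLM.contDiff.comp (contDiff_const.mul f.contDiff)
  · exact f.hasCompactSupport.comp_left (g := fun t : ℝ => (((√M)⁻¹ * t : ℝ) : ℂ)) (by simp)
  · intro x hx
    have : x ∈ Function.support f := fun h0 => hx (by simp [h0])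
    rwa [f.support_eq] at this
  · have : ∀ x, ‖(((√M)⁻¹ * f x : ℝ) : ℂ)‖ ^ 2 = M⁻¹ * f x ^ 2 := fun x => by
      rw [Complex.norm_real, Real.norm_eq_abs, sq_abs, mul_pow, inv_pow, Real.sq_sqrt hM.le]
    simp_rw [this]
    rw [integral_const_mul, inv_mul_cancel₀ hM.ne']

lemma integrable_norm_sq_of_hasCompactSupport {d : ℕ} {F : Type*} [NormedAddCommGroup F]
    {f : Ed d → F} (hf : Continuous f) (hs : HasCompactSupport f) :
    Integrable fun x => ‖f x‖ ^ 2 := by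
  have hs2 : HasCompactSupport fun x => ‖f x‖ ^ 2 :=
    hs.comp_left (g := fun z : F => ‖z‖ ^ 2) (by simp)
  have hf2 : Continuous fun x => ‖f x‖ ^ 2 := by fun_prop
  exact hf2.integrable_of_hasCompactSupport hs2

lemma exists_admissible {d : ℕ} (hd : 1 ≤ d) (N : ℕ) :
    ∃ u : Fin N → Ed d → ℂ, Admissible d N u := by
  obtain ⟨φ, hφ, hcs, hsupp, h1⟩ := exists_normalized_bump (d := d)
  let e : Ed d := EuclideanSpace.single ⟨0, hd⟩ (1 : ℝ)
  let c : Fin N → Ed d := fun n => (2 * (n : ℕ) : ℝ) • e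
  have hderiv : ∀ n x, fderiv ℝ (fun x => φ (x - c n)) x = fderiv ℝ φ (x - c n) := fun n x =>
    fderiv_comp_sub (c n)
  have hdisj : ∀ j k, j ≠ k → ∀ x, φ (x - c j) = 0 ∨ φ (x - c k) = 0 := by
    intro j k hjk x
    by_contra! hne
    have hj := mem_ball_zero_iff.1 (hsupp hne.1)
    have hk := mem_ball_zero_iff.1 (hsupp hne.2)
    have hlt : ‖c j - c k‖ < 2 := by
      have := norm_sub_le (x - c k) (x - c j)
      rw [sub_sub_sub_cancel_left] at this
      linarith
    have hne' : (j : ℕ) ≠ k := fun h => hjk (Fin.ext h)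
    have hge : (1 : ℝ) ≤ |((j : ℕ) : ℝ) - (k : ℕ)| := by
      have : (1 : ℤ) ≤ |((j : ℕ) : ℤ) - (k : ℕ)| := Int.one_le_abs (by omega)
      exact_mod_cast this
    have : ‖c j - c k‖ = 2 * |((j : ℕ) : ℝ) - (k : ℕ)| := by
      rw [← sub_smul, norm_smul, ← mul_sub, Real.norm_eq_abs, abs_mul]
      simp [e]
    linarith
  refine ⟨fun n x => φ (x - c n), fun n => hφ.comp (contDiff_id.sub contDiff_const),
    fun n => ?_, fun n => ?_, fun j k => ?_⟩
  · exact (integrable_norm_sq_of_hasCompactSupport hφ.continuous hcs).comp_sub_right (c n)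
  · simp_rw [hderiv]
    exact (integrable_norm_sq_of_hasCompactSupport (hφ.continuous_fderiv one_ne_zero)
      (hcs.fderiv ℝ)).comp_sub_right (c n)
  · split_ifs with hjk
    · subst hjk
      rw [integral_sub_right_eq_self (fun x => φ x * (starRingEnd ℂ) (φ x)) (c j)]
      simp_rw [Complex.mul_conj']
      have : ((∫ x, ‖φ x‖ ^ 2 : ℝ) : ℂ) = 1 := by rw [h1]; simp
      rw [← this, ← integral_complex_ofReal]
      simp
    · rw [← integral_zero (Ed d) ℂ]
      congr 1
      ext x
      rcases hdisj j k hjk x with h | h <;> simp [h]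

lemma J_zero (d : ℕ) {p : ℝ} (hp : p ≠ 0) : J d p 0 = 0 := by
  have hE : ∀ u : Fin 0 → Ed d → ℂ, energy d 0 p u = 0 := fun u => by
    simp [energy, density, Real.zero_rpow hp]
  have : { e : ℝ | ∃ u : Fin 0 → Ed d → ℂ, Admissible d 0 u ∧ e = energy d 0 p u } = {0} := by
    ext e
    constructor
    · rintro ⟨u, -, rfl⟩
      exact hE u
    · rintro rfl
      exact ⟨fun n => n.elim0, ⟨fun n => n.elim0, fun n => n.elim0, fun n => n.elim0,
        fun n => n.elim0⟩, (hE _).symm⟩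
  rw [J, this, csInf_singleton]

lemma wt_natCast (N : ℕ) (n : Fin N) : wt N N n = 1 := by
  unfold wt
  split_ifs <;> ring

lemma Jw_natCast (d : ℕ) (p : ℝ) (N : ℕ) : Jw d p N = J d p N := by
  unfold Jw
  rw [Nat.ceil_natCast]
  simp [J, energyW, energy, kineticW, densityW, density, wt_natCast]

lemma wt_succ_castSucc (K : ℕ) (lam : ℝ) (n : Fin K) : wt (K + 1) lam n.castSucc = 1 := by
  have := n.isLt
  simp only [wt, Fin.val_castSucc, Nat.add_sub_cancel]
  rw [if_neg (by omega)]

lemma wt_succ_last (K : ℕ) (t : ℝ) : wt (K + 1) (K + t) (Fin.last K) = t := by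
  simp [wt]

lemma ceil_natCast_add {K : ℕ} {t : ℝ} (ht0 : 0 < t) (ht1 : t ≤ 1) : ⌈(K + t : ℝ)⌉₊ = K + 1 := by
  rw [Nat.ceil_eq_iff (by omega)]
  constructor
  · simpa using ht0
  · push_cast; linarith

lemma kineticW_natCast_add {d K : ℕ} (t : ℝ) (u : Fin (K + 1) → Ed d → ℂ) :
    kineticW d (K + 1) (K + t) u = (∑ n : Fin K, ∫ x, ‖fderiv ℝ (u n.castSucc) x‖ ^ 2)
      + t * ∫ x, ‖fderiv ℝ (u (Fin.last K)) x‖ ^ 2 := by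
  simp [kineticW, Fin.sum_univ_castSucc, wt_succ_castSucc, wt_succ_last]

lemma densityW_natCast_add {d K : ℕ} (t : ℝ) (u : Fin (K + 1) → Ed d → ℂ) (x : Ed d) :
    densityW d (K + 1) (K + t) u x =
      density d K (fun n => u n.castSucc) x + t * ‖u (Fin.last K) x‖ ^ 2 := by
  simp [densityW, density, Fin.sum_univ_castSucc, wt_succ_castSucc, wt_succ_last]

/-- The weighted energy is concave in the occupation of the last function. -/
lemma energyW_natCast_add_ge {d : ℕ} (hd : 1 ≤ d) {p : ℝ} (hp1 : 1 < p) (hp2 : p < 1 + 2 / d)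
    {K : ℕ} {t : ℝ} (ht0 : 0 ≤ t) (ht1 : t ≤ 1) {u : Fin (K + 1) → Ed d → ℂ}
    (hu : Admissible d (K + 1) u) :
    (1 - t) * energy d K p (fun n => u n.castSucc) + t * energy d (K + 1) p u
      ≤ energyW d (K + 1) p (K + t) u := by
  obtain ⟨_, -, h0⟩ := exists_integral_density_rpow_le hd hp1 hp2 K
  obtain ⟨_, -, h1⟩ := exists_integral_density_rpow_le hd hp1 hp2 (K + 1)
  have i0 := (h0 _ hu.castSucc).1
  have i1 := (h1 _ hu).1
  have hmix : ∀ x, densityW d (K + 1) (K + t) u x =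
      (1 - t) * density d K (fun n => u n.castSucc) x + t * density d (K + 1) u x := fun x => by
    rw [densityW_natCast_add]
    simp only [density, Fin.sum_univ_castSucc]
    ring
  have hle : ∫ x, densityW d (K + 1) (K + t) u x ^ p ≤
      (1 - t) * (∫ x, density d K (fun n => u n.castSucc) x ^ p)
        + t * ∫ x, density d (K + 1) u x ^ p := by
    rw [← integral_const_mul, ← integral_const_mul,
      ← integral_add (i0.const_mul _) (i1.const_mul _)]
    refine integral_mono_of_nonneg (ae_of_all _ fun x => ?_)
      ((i0.const_mul _).add (i1.const_mul _)) (ae_of_all _ fun x => ?_)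
    · refine Real.rpow_nonneg ?_ p
      rw [hmix]
      exact add_nonneg (mul_nonneg (by linarith) (density_nonneg _ x))
        (mul_nonneg ht0 (density_nonneg _ x))
    · simpa [hmix] using (convexOn_rpow hp1.le).2
        (density_nonneg (fun n : Fin K => u n.castSucc) x) (density_nonneg u x)
        (sub_nonneg.2 ht1) ht0 (by ring)
  have hp : 0 ≤ 1 / p := by positivity
  have := mul_le_mul_of_nonneg_left hle hp
  rw [energyW, kineticW_natCast_add]
  simp only [energy, Fin.sum_univ_castSucc (n := K)]
  linarith

lemma Jw_natCast_add_ge {d : ℕ} (hd : 1 ≤ d) {p : ℝ} (hp1 : 1 < p) (hp2 : p < 1 + 2 / d)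
    {K : ℕ} {t : ℝ} (ht0 : 0 < t) (ht1 : t ≤ 1) :
    (1 - t) * J d p K + t * J d p (K + 1) ≤ Jw d p (K + t) := by
  unfold Jw
  rw [ceil_natCast_add ht0 ht1]
  obtain ⟨v, hv⟩ := exists_admissible hd (K + 1)
  refine le_csInf ⟨_, v, hv, rfl⟩ ?_
  rintro _ ⟨u, hu, rfl⟩
  refine le_trans ?_ (energyW_natCast_add_ge hd hp1 hp2 ht0.le ht1 hu)
  have := sub_nonneg.2 ht1
  gcongr
  · exact J_le_energy hd hp1 hp2 hu.castSucc
  · exact J_le_energy hd hp1 hp2 hu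

lemma admissible_one {d : ℕ} {u : Ed d → ℂ} (hu : ContDiff ℝ 1 u)
    (hi : Integrable fun x => ‖u x‖ ^ 2) (hg : Integrable fun x => ‖fderiv ℝ u x‖ ^ 2)
    (h1 : ∫ x, ‖u x‖ ^ 2 = 1) : Admissible d 1 fun _ => u where
  contDiff _ := hu
  sqInt _ := hi
  gradSqInt _ := hg
  orthonormal j k := by
    rw [if_pos (Subsingleton.elim j k)]
    simp_rw [Complex.mul_conj']
    have : ((∫ x, ‖u x‖ ^ 2 : ℝ) : ℂ) = 1 := by rw [h1]; simp
    rw [← this, ← integral_complex_ofReal]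
    simp

/-- Spreading a fixed profile out makes the interaction dominate the kinetic energy. -/
lemma J_one_neg {d : ℕ} (hd : 1 ≤ d) {p : ℝ} (hp1 : 1 < p) (hp2 : p < 1 + 2 / d) :
    J d p 1 < 0 := by
  obtain ⟨φ, hφ, hcs, -, h1⟩ := exists_normalized_bump (d := d)
  have hd0 : (0 : ℝ) < d := by exact_mod_cast hd
  have hp0 : 0 < p := by linarith
  set T := ∫ x, ‖fderiv ℝ φ x‖ ^ 2
  set P := ∫ x, (‖φ x‖ ^ 2) ^ p
  have hcont : Continuous fun x => (‖φ x‖ ^ 2) ^ p :=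
    (hφ.continuous.norm.pow 2).rpow_const fun _ => Or.inr hp0.le
  have hP : 0 < P := by
    obtain ⟨x, hx⟩ : ∃ x, φ x ≠ 0 := by
      by_contra! h
      simp [h] at h1
    refine hcont.integral_pos_of_hasCompactSupport_nonneg_nonzero ?_
      (fun x => by positivity) (x := x) ?_
    · exact hcs.comp_left (g := fun z : ℂ => (‖z‖ ^ 2) ^ p) (by simp [hp0.ne'])
    · have := norm_pos_iff.2 hx
      positivity
  set a : ℝ := 2 - d * (p - 1)
  have ha : 0 < a := by
    have : p - 1 < 2 / d := by linarith
    rw [lt_div_iff₀ hd0, mul_comm] at this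
    simp only [a]
    linarith
  obtain ⟨δ, hδ, hδT⟩ : ∃ δ : ℝ, 0 < δ ∧ δ ^ a * T < 1 / p * P := by
    have hlim : Tendsto (fun δ : ℝ => δ ^ a * T) (𝓝[>] 0) (𝓝 0) := by
      have : Tendsto (fun δ : ℝ => δ ^ a * T) (𝓝 0) (𝓝 ((0 : ℝ) ^ a * T)) :=
        ((Real.continuousAt_rpow_const 0 a (Or.inr ha.le)).tendsto).mul_const T
      rw [Real.zero_rpow ha.ne', zero_mul] at this
      exact this.mono_left nhdsWithin_le_nhds
    obtain ⟨δ, h, hδ⟩ := ((hlim.eventually_lt_const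
      (show 0 < 1 / p * P by positivity)).and self_mem_nhdsWithin).exists
    exact ⟨δ, hδ, h⟩
  set c : ℝ := √(δ ^ d)
  have hc2 : c ^ 2 = δ ^ d := Real.sq_sqrt (by positivity)
  let u : Ed d → ℂ := fun x => c • φ (δ • x)
  have hscale : ∀ f : Ed d → ℝ, δ ^ d * ∫ x, f (δ • x) = ∫ x, f x := fun f => by
    rw [Measure.integral_comp_smul, finrank_euclideanSpace_fin, smul_eq_mul,
      abs_of_pos (by positivity), ← mul_assoc, mul_inv_cancel₀ (by positivity), one_mul]
  have hnu : ∀ x, ‖u x‖ ^ 2 = δ ^ d * ‖φ (δ • x)‖ ^ 2 := fun x => by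
    rw [norm_smul, mul_pow, Real.norm_eq_abs, sq_abs, hc2]
  have hdu : ∀ x, ‖fderiv ℝ u x‖ ^ 2 = δ ^ d * (δ ^ 2 * ‖fderiv ℝ φ (δ • x)‖ ^ 2) := fun x => by
    have hdiff : DifferentiableAt ℝ (fun y : Ed d => φ (δ • y)) x :=
      (hφ.comp (contDiff_const_smul δ)).differentiable one_ne_zero x
    rw [show u = fun x => c • φ (δ • x) from rfl, fderiv_fun_const_smul hdiff,
      fderiv_comp_smul, norm_smul, norm_smul,
      mul_pow, mul_pow, Real.norm_eq_abs, sq_abs, hc2, Real.norm_eq_abs, sq_abs]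
  have hadm : Admissible d 1 fun _ => u := by
    refine admissible_one ((hφ.comp (contDiff_const_smul δ)).const_smul c) ?_ ?_ ?_
    · simp_rw [hnu]
      exact ((integrable_norm_sq_of_hasCompactSupport hφ.continuous hcs).comp_smul
        hδ.ne').const_mul _
    · simp_rw [hdu]
      exact (((integrable_norm_sq_of_hasCompactSupport (hφ.continuous_fderiv one_ne_zero)
        (hcs.fderiv ℝ)).comp_smul hδ.ne').const_mul _).const_mul _
    · simp_rw [hnu]
      rw [integral_const_mul, hscale (fun x => ‖φ x‖ ^ 2), h1]
  refine (J_le_energy hd hp1 hp2 hadm).trans_lt ?_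
  have hkin : ∫ x, ‖fderiv ℝ u x‖ ^ 2 = δ ^ 2 * T := by
    simp_rw [hdu]
    rw [integral_const_mul, hscale (fun x => δ ^ 2 * ‖fderiv ℝ φ x‖ ^ 2), integral_const_mul]
  have hpot : ∫ x, (‖u x‖ ^ 2) ^ p = δ ^ (d * (p - 1)) * P := by
    have h2 : ∀ x, (‖u x‖ ^ 2) ^ p = δ ^ (d * (p - 1)) * (δ ^ d * (‖φ (δ • x)‖ ^ 2) ^ p) := by
      intro x
      rw [hnu, Real.mul_rpow (by positivity) (by positivity), ← mul_assoc]
      congr 1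
      rw [← Real.rpow_natCast, ← Real.rpow_mul hδ.le, ← Real.rpow_add hδ]
      congr 1
      ring
    simp_rw [h2]
    rw [integral_const_mul, integral_const_mul, hscale (fun x => (‖φ x‖ ^ 2) ^ p)]
  have hfactor : δ ^ 2 = δ ^ (d * (p - 1)) * δ ^ a := by
    rw [← Real.rpow_add hδ, ← Real.rpow_natCast]
    congr 1
    simp [a]
  have hdens : ∀ x, density d 1 (fun _ => u) x = ‖u x‖ ^ 2 := fun x => by simp [density]
  simp_rw [energy, hdens, hpot, Fin.sum_univ_one, hkin, hfactor]
  have : 0 < δ ^ (d * (p - 1)) := by positivity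
  nlinarith

lemma mul_J_one_lt_Jw {d : ℕ} (hd : 1 ≤ d) {p : ℝ} (hp1 : 1 < p) (hp2 : p < 1 + 2 / d)
    {t : ℝ} (ht0 : 0 < t) (ht1 : t < 1) : t * J d p 1 < Jw d p t := by
  have hneg := J_one_neg hd hp1 hp2
  have hp0 : 0 < p := by linarith
  set m := J d p 1
  set s := t ^ (p - 1) with hs
  have hs0 : 0 < s := by positivity
  have hs1 : s < 1 := Real.rpow_lt_one ht0.le ht1 (by linarith)
  have htp : t ^ p = t * s := by
    rw [hs, ← Real.rpow_one_add' ht0.le (by linarith)]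
    congr 1
    ring
  have hceil : ⌈t⌉₊ = 1 := by simpa using ceil_natCast_add (K := 0) ht0 ht1.le
  have key : t * (s * m) ≤ Jw d p t := by
    unfold Jw
    rw [hceil]
    obtain ⟨v, hv⟩ := exists_admissible hd 1
    refine le_csInf ⟨_, v, hv, rfl⟩ ?_
    rintro _ ⟨u, hu, rfl⟩
    have h := J_le_energy hd hp1 hp2 hu
    have hT : 0 ≤ ∫ x, ‖fderiv ℝ (u 0) x‖ ^ 2 := integral_nonneg fun x => by positivity
    have hE : energyW d 1 p t u = t * (∫ x, ‖fderiv ℝ (u 0) x‖ ^ 2) -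
        1 / p * (t * s * ∫ x, density d 1 u x ^ p) := by
      rw [← htp]
      simp only [energyW, kineticW, densityW, density, wt, Fin.sum_univ_one]
      simp [Real.mul_rpow ht0.le (sq_nonneg ‖u 0 _‖), integral_const_mul]
    simp only [energy, Fin.sum_univ_one] at h
    rw [hE]
    set Q := ∫ x, density d 1 u x ^ p
    have : t * (s * m) ≤ t * (s * ((∫ x, ‖fderiv ℝ (u 0) x‖ ^ 2) - 1 / p * Q)) := by gcongr
    nlinarith [mul_nonneg ht0.le (mul_nonneg (sub_nonneg.2 hs1.le) hT)]
  refine lt_of_lt_of_le ?_ key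
  have : m < s * m := by nlinarith
  exact mul_lt_mul_of_pos_left this ht0

/-- the discrete binding inequalities imply the continuous
binding inequalities. -/
theorem statement12 (d : ℕ) (hd : 1 ≤ d) (p : ℝ) (hp1 : 1 < p)
    (hp2 : p < 1 + 2 / d) (N : ℕ)
    (hbind : ∀ K : ℕ, 1 ≤ K → K ≤ N - 1 → J d p N < J d p K + J d p (N - K)) :
    ∀ lam' : ℝ, 0 < lam' → lam' < N →
      Jw d p N < Jw d p lam' + Jw d p ((N : ℝ) - lam') := by
  intro lam' h0 hN
  have hp0 : p ≠ 0 := by linarith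
  rw [Jw_natCast]
  rcases Nat.lt_or_ge N 2 with hN2 | hN2
  · have hN1 : N = 1 := by
      have : 0 < N := by exact_mod_cast h0.trans hN
      omega
    subst hN1
    simp only [Nat.cast_one] at hN ⊢
    have h1 := mul_J_one_lt_Jw hd hp1 hp2 h0 hN
    have h2 := mul_J_one_lt_Jw hd hp1 hp2 (t := 1 - lam') (by linarith) (by linarith)
    linarith
  obtain ⟨K, hK⟩ : ∃ K, ⌈lam'⌉₊ = K + 1 :=
    Nat.exists_eq_succ_of_ne_zero (Nat.ceil_pos.2 h0).ne'
  obtain ⟨hKl, hKu⟩ := (Nat.ceil_eq_iff (Nat.succ_ne_zero K)).1 hK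
  simp only [Nat.succ_eq_add_one, Nat.add_sub_cancel, Nat.cast_add, Nat.cast_one] at hKl hKu
  obtain ⟨t, rfl⟩ : ∃ t, lam' = K + t := ⟨lam' - K, by ring⟩
  have ht0 : 0 < t := by linarith
  have ht1 : t ≤ 1 := by linarith
  have hKN : K < N := by
    have : (K : ℝ) < N := by linarith
    exact_mod_cast this
  obtain ⟨L, rfl⟩ : ∃ L, N = K + 1 + L := ⟨N - (K + 1), by omega⟩
  have hJ0 := J_zero d hp0
  rcases ht1.lt_or_eq with ht1 | rfl
  · have e : ((K + 1 + L : ℕ) : ℝ) - (K + t) = L + (1 - t) := by push_cast; ring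
    rw [e]
    have h1 := Jw_natCast_add_ge hd hp1 hp2 (K := K) ht0 ht1.le
    have h2 := Jw_natCast_add_ge hd hp1 hp2 (K := L) (t := 1 - t) (by linarith) (by linarith)
    have hsum : J d p (K + 1 + L) < (1 - t) * (J d p K + J d p (L + 1))
        + t * (J d p (K + 1) + J d p L) := by
      have hleft : 1 ≤ K → J d p (K + 1 + L) < J d p K + J d p (L + 1) := fun h => by
        have := hbind K h (by omega)
        rwa [show K + 1 + L - K = L + 1 by omega] at this
      have hright : 1 ≤ L → J d p (K + 1 + L) < J d p (K + 1) + J d p L := fun h => by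
        have := hbind (K + 1) (by omega) (by omega)
        rwa [show K + 1 + L - (K + 1) = L by omega] at this
      rcases Nat.eq_zero_or_pos K with rfl | hKpos
      · have hr := hright (by omega)
        rw [hJ0, zero_add, add_comm L 1]
        rw [zero_add] at hr ⊢
        nlinarith
      · have hl := hleft hKpos
        rcases Nat.eq_zero_or_pos L with rfl | hLpos
        · rw [hJ0, add_zero] at *
          nlinarith
        · have hr := hright hLpos
          nlinarith
    linarith
  · have hL : 1 ≤ L := by
      have : (0 : ℝ) < L := by push_cast at hN; linarith
      exact_mod_cast this
    have e1 : (K : ℝ) + 1 = ((K + 1 : ℕ) : ℝ) := by push_cast; ring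
    have e2 : ((K + 1 + L : ℕ) : ℝ) - ((K + 1 : ℕ) : ℝ) = (L : ℕ) := by push_cast; ring
    rw [e1, e2, Jw_natCast, Jw_natCast]
    have := hbind (K + 1) (by omega) (by omega)
    rwa [show K + 1 + L - (K + 1) = L by omega] at this
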